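/- Let Ū and U be n×d real matrices with orthonormal columns such that ŪᵀU is invertible, and let A be an m×n real matrix such that AU has full column rank d. Let s ∈ ℝ^d, v = Ūs, v_⊥ = (I_n − UUᵀ)v, w = (UᵀAᵀAU)⁻¹UᵀAᵀAv, p = Uw, r̃ = Av − AUw, and r = Aᵀr̃; assume p ≠ 0 and r ≠ 0. Let U₊ = U + ((p + r)/‖p + r‖ − p/‖p‖) wᵀ/‖w‖ and set Δ = w_⊥ᵀ(ŪᵀU)⁻¹Ūᵀ r, where w_⊥ = (UᵀAᵀAU)⁻¹UᵀAᵀA v_⊥. Then ζ(U₊)/ζ(U) ≥ 1 + (2‖r̃‖² − ‖r‖²)/‖p‖² + 2Δ/‖p‖², where ζ(M) = det(ŪᵀM MᵀŪ). -/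

import Mathlib

open Matrix

/-- The Euclidean (ℓ²) norm of a vector in `ℝ^k`. -/
noncomputable def l2norm {k : ℕ} (v : Fin k → ℝ) : ℝ := Real.sqrt (∑ i, v i ^ 2)

/-- Determinant similarity `ζ(M) = det(ŪᵀM MᵀŪ)` relative to a fixed `Ū`. -/
noncomputable def detSim {n d : ℕ} (Ubar M : Matrix (Fin n) (Fin d) ℝ) : ℝ :=
  (Ubarᵀ * M * Mᵀ * Ubar).det

theorem l2norm_sq {k : ℕ} (v : Fin k → ℝ) : l2norm v ^ 2 = v ⬝ᵥ v := by
  rw [l2norm, Real.sq_sqrt (Finset.sum_nonneg fun i _ => sq_nonneg _)]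
  simp [dotProduct, sq]

theorem l2norm_nonneg {k : ℕ} (v : Fin k → ℝ) : 0 ≤ l2norm v := Real.sqrt_nonneg _

theorem l2norm_pos {k : ℕ} {v : Fin k → ℝ} (hv : v ≠ 0) : 0 < l2norm v := by
  refine (l2norm_nonneg v).lt_of_ne' fun h => hv ?_
  rw [← dotProduct_self_eq_zero, ← l2norm_sq, h, zero_pow two_ne_zero]

theorem l2norm_add_sq {k : ℕ} {u v : Fin k → ℝ} (h : u ⬝ᵥ v = 0) :
    l2norm (u + v) ^ 2 = l2norm u ^ 2 + l2norm v ^ 2 := by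
  simp only [l2norm_sq, add_dotProduct, dotProduct_add, dotProduct_comm v u, h]
  ring

theorem l2norm_mulVec_of_transpose_mul_self {n d : ℕ} {U : Matrix (Fin n) (Fin d) ℝ}
    (hU : Uᵀ * U = 1) (w : Fin d → ℝ) : l2norm (U *ᵥ w) = l2norm w := by
  rw [← sq_eq_sq₀ (l2norm_nonneg _) (l2norm_nonneg _), l2norm_sq, l2norm_sq,
    dotProduct_mulVec, ← mulVec_transpose, mulVec_mulVec, hU, one_mulVec]

theorem detSim_eq_sq {n d : ℕ} (Ubar M : Matrix (Fin n) (Fin d) ℝ) :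
    detSim Ubar M = (Ubarᵀ * M).det ^ 2 := by
  rw [detSim, Matrix.mul_assoc, det_mul, ← det_transpose (Mᵀ * Ubar), transpose_mul,
    transpose_transpose, sq]

theorem isUnit_of_rank_eq {d : ℕ} {M : Matrix (Fin d) (Fin d) ℝ} (h : M.rank = d) :
    IsUnit M := by
  rw [← mulVec_surjective_iff_isUnit]
  have htop : LinearMap.range M.mulVecLin = ⊤ :=
    Submodule.eq_top_of_finrank_eq (by rw [← Matrix.rank, h]; simp)
  exact LinearMap.range_eq_top.mp htop

theorem det_add_vecMulVec_of_isUnit {d : ℕ} {B : Matrix (Fin d) (Fin d) ℝ} (hB : IsUnit B)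
    (u v : Fin d → ℝ) : (B + vecMulVec u v).det = B.det * (1 + v ⬝ᵥ B⁻¹ *ᵥ u) := by
  rw [vecMulVec_eq Unit,
    det_add_replicateCol_mul_replicateRow ((Matrix.isUnit_iff_isUnit_det _).mp hB),
    ← replicateRow_vecMul, ← det_one_add_mul_comm, det_one_add_replicateCol_mul_replicateRow,
    dotProduct_mulVec]

/-- A rank-one perturbation changes the determinant similarity by the square of the factor in the
matrix determinant lemma. -/
theorem detSim_add_vecMulVec_div {n d : ℕ} {Ubar U : Matrix (Fin n) (Fin d) ℝ}
    (hinv : IsUnit (Ubarᵀ * U)) (a : Fin n → ℝ) (b : Fin d → ℝ) :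
    detSim Ubar (U + vecMulVec a b) / detSim Ubar U =
      (1 + b ⬝ᵥ ((Ubarᵀ * U)⁻¹ * Ubarᵀ) *ᵥ a) ^ 2 := by
  have hdet : (Ubarᵀ * U).det ≠ 0 := ((Matrix.isUnit_iff_isUnit_det _).mp hinv).ne_zero
  rw [detSim_eq_sq, detSim_eq_sq, Matrix.mul_add, mul_vecMulVec,
    det_add_vecMulVec_of_isUnit hinv, mulVec_mulVec]
  field_simp

theorem one_add_div_le_sq_of_sq_eq {P R β x y : ℝ} (hx : 0 < x) (hy : 0 < y)
    (hxP : x ^ 2 = P) (hyP : y ^ 2 = P + R) :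
    1 + (2 * β - R) / P ≤ (1 + 1 / x * (1 / y * (P + β) - 1 / x * P)) ^ 2 := by
  have hP : 0 < P := hxP ▸ pow_pos hx 2
  have hPR : 0 < P + R := hyP ▸ pow_pos hy 2
  have hfactor : 1 + 1 / x * (1 / y * (P + β) - 1 / x * P) = (P + β) / (x * y) := by
    subst hxP
    field_simp
    ring
  rw [hfactor, div_pow, mul_pow, hxP, hyP, one_add_div hP.ne', div_le_div_iff₀ hP (by positivity)]
  nlinarith [mul_nonneg hP.le (sq_nonneg (β - R))]

/-- lower bound on the determinant-similarity ratio for one undersampled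
GROUSE update: `ζ(U₊)/ζ(U) ≥ 1 + (2‖r̃‖² − ‖r‖²)/‖p‖² + 2Δ/‖p‖²`. -/
theorem grouse_undersampled_detSim_ratio {n d m : ℕ}
    (Ubar U : Matrix (Fin n) (Fin d) ℝ)
    (hUbar : Ubarᵀ * Ubar = 1) (hU : Uᵀ * U = 1)
    (hinv : IsUnit (Ubarᵀ * U))
    (A : Matrix (Fin m) (Fin n) ℝ) (hrank : (A * U).rank = d)
    (s : Fin d → ℝ)
    (v : Fin n → ℝ) (hv : v = Ubar.mulVec s)
    (vperp : Fin n → ℝ) (hvperp : vperp = v - (U * Uᵀ).mulVec v)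
    (w : Fin d → ℝ)
    (hw : w = ((Uᵀ * Aᵀ * A * U)⁻¹ * (Uᵀ * Aᵀ * A)).mulVec v)
    (p : Fin n → ℝ) (hp : p = U.mulVec w)
    (rtil : Fin m → ℝ) (hrtil : rtil = A.mulVec v - (A * U).mulVec w)
    (r : Fin n → ℝ) (hr : r = Aᵀ.mulVec rtil)
    (hp0 : p ≠ 0) (hr0 : r ≠ 0)
    (Uplus : Matrix (Fin n) (Fin d) ℝ)
    (hUplus : Uplus = U + Matrix.vecMulVec
      (fun i => (p i + r i) / l2norm (p + r) - p i / l2norm p)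
      (fun j => w j / l2norm w))
    (wperp : Fin d → ℝ)
    (hwperp : wperp = ((Uᵀ * Aᵀ * A * U)⁻¹ * (Uᵀ * Aᵀ * A)).mulVec vperp)
    (Δ : ℝ) (hΔ : Δ = wperp ⬝ᵥ ((Ubarᵀ * U)⁻¹ * Ubarᵀ).mulVec r) :
    1 + (2 * l2norm rtil ^ 2 - l2norm r ^ 2) / l2norm p ^ 2 + 2 * Δ / l2norm p ^ 2
      ≤ detSim Ubar Uplus / detSim Ubar U := by
  set B := Ubarᵀ * U with hB
  set K := B⁻¹ * Ubarᵀ with hK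
  set N := Uᵀ * Aᵀ * A * U with hN
  have hBdet : IsUnit B.det := (Matrix.isUnit_iff_isUnit_det _).mp hinv
  have hNdet : IsUnit N.det := by
    refine (Matrix.isUnit_iff_isUnit_det _).mp (isUnit_of_rank_eq ?_)
    rw [hN, Matrix.mul_assoc (Uᵀ * Aᵀ), ← transpose_mul, rank_transpose_mul_self, hrank]
  have hKU : K * U = 1 := by
    rw [hK, Matrix.mul_assoc, ← hB, nonsing_inv_mul _ hBdet]
  have hUr : Uᵀ *ᵥ r = 0 := by
    have hnormal : N *ᵥ w = (Uᵀ * Aᵀ * A) *ᵥ v := by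
      rw [hw, mulVec_mulVec, ← Matrix.mul_assoc, mul_nonsing_inv _ hNdet, Matrix.one_mul]
    rw [hr, hrtil, mulVec_sub, mulVec_sub]
    simp only [mulVec_mulVec, ← Matrix.mul_assoc]
    rw [← hN, hnormal, sub_self]
  have hUr' (x : Fin d → ℝ) : U *ᵥ x ⬝ᵥ r = 0 := by
    rw [dotProduct_comm, dotProduct_mulVec, ← mulVec_transpose, hUr, zero_dotProduct]
  have hvr : v ⬝ᵥ r = l2norm rtil ^ 2 := by
    have hsplit : A *ᵥ v = rtil + A *ᵥ (U *ᵥ w) := by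
      rw [hrtil, mulVec_mulVec, sub_add_cancel]
    have hAr (x : Fin n → ℝ) : x ⬝ᵥ r = A *ᵥ x ⬝ᵥ rtil := by
      rw [hr, dotProduct_mulVec, vecMul_transpose]
    rw [hAr, hsplit, add_dotProduct, ← hAr, hUr', add_zero, l2norm_sq]
  have hwsplit : w = wperp + Uᵀ *ᵥ v := by
    have hGU : N⁻¹ * (Uᵀ * Aᵀ * A) * U = 1 := by
      rw [Matrix.mul_assoc, ← hN, nonsing_inv_mul _ hNdet]
    rw [hwperp, hvperp, mulVec_sub, ← hw, mulVec_mulVec, ← Matrix.mul_assoc, hGU,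
      Matrix.one_mul, sub_add_cancel]
  have hβ : w ⬝ᵥ K *ᵥ r = Δ + l2norm rtil ^ 2 := by
    have hUv : Uᵀ *ᵥ v ⬝ᵥ K *ᵥ r = v ⬝ᵥ r := by
      rw [hv, hK, mulVec_mulVec, show Uᵀ * Ubar = Bᵀ by simp [hB], mulVec_transpose,
        ← dotProduct_mulVec, mulVec_mulVec, mul_nonsing_inv_cancel_left _ _ hBdet,
        dotProduct_mulVec, vecMul_transpose]
    rw [hwsplit, add_dotProduct, ← hΔ, hUv, hvr]
  have hpw : l2norm p = l2norm w := by rw [hp, l2norm_mulVec_of_transpose_mul_self hU]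
  have hKp : w ⬝ᵥ K *ᵥ p = l2norm p ^ 2 := by
    rw [hp, mulVec_mulVec, hKU, one_mulVec, ← hp, hpw, l2norm_sq]
  have hppos : 0 < l2norm p := l2norm_pos hp0
  have hpr : l2norm (p + r) ^ 2 = l2norm p ^ 2 + l2norm r ^ 2 :=
    l2norm_add_sq (by rw [hp, hUr'])
  have hprpos : 0 < l2norm (p + r) :=
    (l2norm_nonneg _).lt_of_ne' fun h => by rw [h] at hpr; nlinarith [sq_nonneg (l2norm r)]
  have hdir : (fun i => (p i + r i) / l2norm (p + r) - p i / l2norm p) =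
      (1 / l2norm (p + r)) • (p + r) - (1 / l2norm p) • p := by
    ext i
    simp only [Pi.sub_apply, Pi.smul_apply, Pi.add_apply, smul_eq_mul]
    ring
  have hcoef : (fun j => w j / l2norm w) = (1 / l2norm p) • w := by
    ext j
    simp only [Pi.smul_apply, smul_eq_mul, hpw]
    ring
  have hbound := one_add_div_le_sq_of_sq_eq (β := Δ + l2norm rtil ^ 2) hppos hprpos rfl hpr
  rw [hUplus, hdir, hcoef, detSim_add_vecMulVec_div hinv, ← hB, ← hK]
  simp only [mulVec_sub, mulVec_smul, mulVec_add, smul_dotProduct, dotProduct_sub,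
    dotProduct_smul, dotProduct_add, smul_eq_mul, hKp, hβ]
  convert hbound using 1 <;> ring
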